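/- Let d ≥ 2, let (F1,F2,F3) be a triple of complete flags of ℂ^d in general position, let (z_j)_{j∈B} be a family of nonzero complex numbers, and let ℓ ⊂ ℂ^d be a 1-dimensional subspace such that F2^{k−1} + F1^{d−k} + ℓ = ℂ^d for every k ∈ {1,…,d}. Then there exists a unique unipotent u ∈ GL_d(ℂ) such that: u preserves the flag F2; u(F3^1) = ℓ; the triple (F1,F2,u·F3) is in general position; and T^j(F1,F2,u·F3) = z_j·T^j(F1,F2,F3) for every j ∈ B. -/

import Mathlib

noncomputable section

/-- A complete flag of `ℂ^d`: an increasing chain of subspaces `F 0 ⊆ F 1 ⊆ ⋯` of `ℂ^d`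
with `dim (F k) = k` for all `k ≤ d`. -/
def IsCompleteFlag (d : ℕ) (F : ℕ → Submodule ℂ (Fin d → ℂ)) : Prop :=
  Monotone F ∧ ∀ k, k ≤ d → Module.finrank ℂ ↥(F k) = k

/-- Two complete flags of `ℂ^d` are transverse: `F^k + G^(d-k) = ℂ^d` for all `k`. -/
def TransverseFlags (d : ℕ) (F G : ℕ → Submodule ℂ (Fin d → ℂ)) : Prop :=
  ∀ k, k ≤ d → F k ⊔ G (d - k) = ⊤

/-- The flag `g · F`, whose subspaces are the images `g (F k)`. -/
def flagMap (d : ℕ) (g : Matrix (Fin d) (Fin d) ℂ) (F : ℕ → Submodule ℂ (Fin d → ℂ)) :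
    ℕ → Submodule ℂ (Fin d → ℂ) :=
  fun k => Submodule.map g.mulVecLin (F k)

/-- A triple of flags of `ℂ^d` in general position:
`F1^k1 + F2^k2 + F3^k3 = ℂ^d` whenever `k1 + k2 + k3 = d`. -/
def GenPos3 (d : ℕ) (F1 F2 F3 : ℕ → Submodule ℂ (Fin d → ℂ)) : Prop :=
  ∀ k1 k2 k3 : ℕ, k1 + k2 + k3 = d → F1 k1 ⊔ F2 k2 ⊔ F3 k3 = ⊤

/-- The index set `B`: triples of positive integers summing to `d`. -/
def memB (d : ℕ) (j : ℕ × ℕ × ℕ) : Prop :=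
  0 < j.1 ∧ 0 < j.2.1 ∧ 0 < j.2.2 ∧ j.1 + j.2.1 + j.2.2 = d

/-- The index set `A`: pairs of positive integers summing to `d`. -/
def memA (d : ℕ) (i : ℕ × ℕ) : Prop :=
  0 < i.1 ∧ 0 < i.2 ∧ i.1 + i.2 = d

/-- `v 0, v 1, …, v (d-1)` is a basis adapted to the flag `F`: for every `k ≤ d`, the
subspace `F k` is spanned by the first `k` vectors.  A nonzero element `f^k` of the line
`⋀^k F^k` is then given by `v 0 ∧ ⋯ ∧ v (k-1)`. -/
def IsAdaptedBasis (d : ℕ) (F : ℕ → Submodule ℂ (Fin d → ℂ)) (v : ℕ → Fin d → ℂ) : Prop :=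
  ∀ k, k ≤ d → F k = Submodule.span ℂ (v '' {m | m < k})

/-- A choice of adapted basis for a flag. -/
noncomputable def flagBasis (d : ℕ) (F : ℕ → Submodule ℂ (Fin d → ℂ)) : ℕ → Fin d → ℂ :=
  Classical.epsilon (IsAdaptedBasis d F)

/-- The scalar `f1^a ∧ f2^b ∧ f3^(d-a-b)`: the wedge product of the first `a` vectors of
`v1`, the first `b` vectors of `v2` and the first `d - a - b` vectors of `v3`, viewed as a
complex number via the determinant (i.e. via the standard identification `⋀^d ℂ^d ≅ ℂ`). -/
noncomputable def wedgeDet (d a b : ℕ) (v1 v2 v3 : ℕ → Fin d → ℂ) : ℂ :=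
  Matrix.det (Matrix.of fun (i j : Fin d) =>
    if (i : ℕ) < a then v1 (i : ℕ) j
    else if (i : ℕ) < a + b then v2 ((i : ℕ) - a) j
    else v3 ((i : ℕ) - a - b) j)

/-- The triple ratio `T^j(F1,F2,F3)` of a triple of flags in general position,
for `j = (j1,j2,j3)` with `j1 + j2 + j3 = d`. -/
noncomputable def tripleRatio (d : ℕ) (j : ℕ × ℕ × ℕ)
    (F1 F2 F3 : ℕ → Submodule ℂ (Fin d → ℂ)) : ℂ :=
  (wedgeDet d (j.1 + 1) j.2.1 (flagBasis d F1) (flagBasis d F2) (flagBasis d F3) *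
      wedgeDet d j.1 (j.2.1 - 1) (flagBasis d F1) (flagBasis d F2) (flagBasis d F3) *
      wedgeDet d (j.1 - 1) (j.2.1 + 1) (flagBasis d F1) (flagBasis d F2) (flagBasis d F3)) /
    (wedgeDet d (j.1 - 1) j.2.1 (flagBasis d F1) (flagBasis d F2) (flagBasis d F3) *
      wedgeDet d j.1 (j.2.1 + 1) (flagBasis d F1) (flagBasis d F2) (flagBasis d F3) *
      wedgeDet d (j.1 + 1) (j.2.1 - 1) (flagBasis d F1) (flagBasis d F2) (flagBasis d F3))

/-- A choice of nonzero vector in a (1-dimensional) subspace. -/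
noncomputable def lineVec (d : ℕ) (l : Submodule ℂ (Fin d → ℂ)) : Fin d → ℂ :=
  Classical.epsilon fun v => v ∈ l ∧ v ≠ 0

/-- The double ratio `D^i(G1,G2,ℓ1,ℓ2)` of a pair of transverse flags and a pair of lines,
for `i = (i1,i2)` with `i1 + i2 = d`. -/
noncomputable def doubleRatioLine (d : ℕ) (i : ℕ × ℕ) (G1 G2 : ℕ → Submodule ℂ (Fin d → ℂ))
    (l1 l2 : Submodule ℂ (Fin d → ℂ)) : ℂ :=
  -((wedgeDet d i.1 (i.2 - 1) (flagBasis d G1) (flagBasis d G2) (fun _ => lineVec d l1) *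
        wedgeDet d (i.1 - 1) i.2 (flagBasis d G1) (flagBasis d G2) (fun _ => lineVec d l2)) /
      (wedgeDet d i.1 (i.2 - 1) (flagBasis d G1) (flagBasis d G2) (fun _ => lineVec d l2) *
        wedgeDet d (i.1 - 1) i.2 (flagBasis d G1) (flagBasis d G2) (fun _ => lineVec d l1)))

/-- The double ratio `D^i(G1,G2,H1,H2)` of four flags, which only depends on the
`1`-dimensional parts of `H1` and `H2`. -/
noncomputable def doubleRatio (d : ℕ) (i : ℕ × ℕ)
    (G1 G2 H1 H2 : ℕ → Submodule ℂ (Fin d → ℂ)) : ℂ :=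
  doubleRatioLine d i G1 G2 (H1 1) (H2 1)

/-- Span of the first `k` vectors. -/
def spn {d : ℕ} (v : ℕ → Fin d → ℂ) (k : ℕ) : Submodule ℂ (Fin d → ℂ) :=
  Submodule.span ℂ (v '' {m | m < k})

lemma mem_spn {d : ℕ} (v : ℕ → Fin d → ℂ) {i k : ℕ} (h : i < k) : v i ∈ spn v k :=
  Submodule.subset_span ⟨i, h, rfl⟩

lemma spn_le {d : ℕ} {v : ℕ → Fin d → ℂ} {k : ℕ} {S : Submodule ℂ (Fin d → ℂ)}
    (h : ∀ i < k, v i ∈ S) : spn v k ≤ S := by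
  unfold spn
  rw [Submodule.span_le]
  rintro _ ⟨i, hi, rfl⟩
  exact h i hi

lemma spn_zero {d : ℕ} (v : ℕ → Fin d → ℂ) : spn v 0 = ⊥ := by
  simp [spn]

lemma spn_mono {d : ℕ} (v : ℕ → Fin d → ℂ) : Monotone (spn v) := by
  intro a b h
  exact spn_le fun i hi => mem_spn v (lt_of_lt_of_le hi h)

lemma spn_succ {d : ℕ} (v : ℕ → Fin d → ℂ) (k : ℕ) :
    spn v (k + 1) = spn v k ⊔ Submodule.span ℂ {v k} := by
  apply le_antisymm
  · apply spn_le
    intro i hi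
    rcases Nat.lt_succ_iff_lt_or_eq.mp hi with h | rfl
    · exact Submodule.mem_sup_left (mem_spn v h)
    · exact Submodule.mem_sup_right (Submodule.mem_span_singleton_self _)
  · apply sup_le (spn_mono v (Nat.le_succ k))
    rw [Submodule.span_singleton_le_iff_mem]
    exact mem_spn v (Nat.lt_succ_self k)

lemma spn_congr {d : ℕ} {v w : ℕ → Fin d → ℂ} {k : ℕ} (h : ∀ i < k, v i = w i) :
    spn v k = spn w k := by
  apply le_antisymm
  · exact spn_le fun i hi => h i hi ▸ mem_spn w hi
  · exact spn_le fun i hi => (h i hi).symm ▸ mem_spn v hi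

lemma wedge_ne_zero_iff {d a b c : ℕ} (habc : a + b + c = d) (v1 v2 v3 : ℕ → Fin d → ℂ) :
    wedgeDet d a b v1 v2 v3 ≠ 0 ↔ spn v1 a ⊔ spn v2 b ⊔ spn v3 c = ⊤ := by
  unfold wedgeDet
  rw [← isUnit_iff_ne_zero, ← Matrix.isUnit_iff_isUnit_det,
    ← Matrix.linearIndependent_rows_iff_isUnit]
  set M : Matrix (Fin d) (Fin d) ℂ := Matrix.of fun (i j : Fin d) =>
    if (i : ℕ) < a then v1 (i : ℕ) j
    else if (i : ℕ) < a + b then v2 ((i : ℕ) - a) j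
    else v3 ((i : ℕ) - a - b) j with hM
  have hrow : ∀ i : Fin d, M.row i = if (i : ℕ) < a then v1 (i : ℕ)
      else if (i : ℕ) < a + b then v2 ((i : ℕ) - a) else v3 ((i : ℕ) - a - b) := by
    intro i
    ext j
    simp only [Matrix.row, hM, Matrix.of_apply]
    split_ifs <;> rfl
  have hspan : Submodule.span ℂ (Set.range M.row) = spn v1 a ⊔ spn v2 b ⊔ spn v3 c := by
    apply le_antisymm
    · rw [Submodule.span_le]
      rintro _ ⟨i, rfl⟩
      rw [hrow]
      split_ifs with h h'
      · exact Submodule.mem_sup_left (Submodule.mem_sup_left (mem_spn v1 h))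
      · exact Submodule.mem_sup_left (Submodule.mem_sup_right (mem_spn v2 (by omega)))
      · exact Submodule.mem_sup_right (mem_spn v3 (by omega))
    · refine sup_le (sup_le (spn_le ?_) (spn_le ?_)) (spn_le ?_)
      · intro i hi
        apply Submodule.subset_span
        refine ⟨⟨i, by omega⟩, ?_⟩
        rw [hrow]; simp [hi]
      · intro i hi
        apply Submodule.subset_span
        refine ⟨⟨a + i, by omega⟩, ?_⟩
        rw [hrow]; simp [hi]
      · intro i hi
        apply Submodule.subset_span
        refine ⟨⟨a + b + i, by omega⟩, ?_⟩
        rw [hrow]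
        have e1 : ¬ (a + b + i < a) := by omega
        have e2 : ¬ (a + b + i < a + b) := by omega
        have e3 : a + b + i - a - b = i := by omega
        simp [e1, e3]
  rw [← hspan]
  constructor
  · intro h
    exact h.span_eq_top_of_card_eq_finrank' (by simp)
  · intro h
    exact linearIndependent_of_top_le_span_of_card_eq_finrank h.ge (by simp)

lemma wedge_congr {d a b c : ℕ} (habc : a + b + c = d) (v1 v2 : ℕ → Fin d → ℂ)
    {v3 w3 : ℕ → Fin d → ℂ} (h : ∀ i < c, v3 i = w3 i) :
    wedgeDet d a b v1 v2 v3 = wedgeDet d a b v1 v2 w3 := by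
  unfold wedgeDet
  congr 1
  ext i j
  simp only [Matrix.of_apply]
  split_ifs
  · rfl
  · rfl
  · rw [h _ (by omega)]

lemma wedge_update {d a b c : ℕ} (habc : a + b + c + 1 = d) (v1 v2 v3 : ℕ → Fin d → ℂ)
    (x : Fin d → ℂ) :
    wedgeDet d a b v1 v2 (Function.update v3 c x) =
      (Matrix.updateRow (Matrix.of fun (i j : Fin d) =>
    if (i : ℕ) < a then v1 (i : ℕ) j
    else if (i : ℕ) < a + b then v2 ((i : ℕ) - a) j
    else v3 ((i : ℕ) - a - b) j) (⟨d - 1, by omega⟩ : Fin d) x).det := by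
  unfold wedgeDet
  congr 1
  ext i j
  rw [Matrix.updateRow_apply]
  simp only [Matrix.of_apply]
  by_cases hi : i = (⟨d - 1, by omega⟩ : Fin d)
  · have hv : (i : ℕ) = d - 1 := by rw [hi]
    rw [if_pos hi, if_neg (by omega), if_neg (by omega)]
    have : (i : ℕ) - a - b = c := by omega
    rw [this, Function.update_self]
  · have hv : (i : ℕ) ≠ d - 1 := fun h => hi (Fin.ext h)
    rw [if_neg hi]
    split_ifs
    · rfl
    · rfl
    · rw [Function.update_of_ne]
      omega

lemma wedge_update_add {d a b c : ℕ} (habc : a + b + c + 1 = d) (v1 v2 v3 : ℕ → Fin d → ℂ)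
    (x y : Fin d → ℂ) :
    wedgeDet d a b v1 v2 (Function.update v3 c (x + y)) =
      wedgeDet d a b v1 v2 (Function.update v3 c x) +
      wedgeDet d a b v1 v2 (Function.update v3 c y) := by
  simp only [wedge_update habc, Matrix.det_updateRow_add]

lemma wedge_update_smul {d a b c : ℕ} (habc : a + b + c + 1 = d) (v1 v2 v3 : ℕ → Fin d → ℂ)
    (t : ℂ) (x : Fin d → ℂ) :
    wedgeDet d a b v1 v2 (Function.update v3 c (t • x)) =
      t * wedgeDet d a b v1 v2 (Function.update v3 c x) := by
  simp only [wedge_update habc, Matrix.det_updateRow_smul]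

lemma exists_coeff {d : ℕ} {v : ℕ → Fin d → ℂ} {n : ℕ} {x : Fin d → ℂ} (h : x ∈ spn v n) :
    ∃ s : ℕ → ℂ, x = ∑ k ∈ Finset.range n, s k • v k := by
  induction n generalizing x with
  | zero => rw [spn_zero] at h; exact ⟨0, by simpa using h⟩
  | succ n ih =>
    rw [spn_succ, Submodule.mem_sup] at h
    obtain ⟨y, hy, z, hz, rfl⟩ := h
    obtain ⟨s, rfl⟩ := ih hy
    obtain ⟨t, rfl⟩ := Submodule.mem_span_singleton.mp hz
    refine ⟨Function.update s n t, ?_⟩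
    rw [Finset.sum_range_succ, Function.update_self]
    congr 1
    apply Finset.sum_congr rfl
    intro k hk
    rw [Function.update_of_ne]
    have := Finset.mem_range.mp hk
    omega

lemma wedge_change {d : ℕ} {v w : ℕ → Fin d → ℂ} (h : ∀ i < d, w i ∈ spn v (i + 1)) :
    ∃ lam : ℕ → ℂ, ∀ (v1 v2 : ℕ → Fin d → ℂ) (a b c : ℕ), a + b + c = d →
      wedgeDet d a b v1 v2 w = lam c * wedgeDet d a b v1 v2 v := by
  have h' : ∀ i, ∃ s : ℕ → ℂ, (∀ k, i < k → s k = 0) ∧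
      (i < d → w i = ∑ k ∈ Finset.range (i + 1), s k • v k) := by
    intro i
    by_cases hi : i < d
    · obtain ⟨s, hs⟩ := exists_coeff (h i hi)
      refine ⟨fun k => if i < k then 0 else s k, fun k hk => by simp [hk], fun _ => ?_⟩
      rw [hs]
      apply Finset.sum_congr rfl
      intro k hk
      have := Finset.mem_range.mp hk
      have q : ¬ i < k := by omega
      simp only [if_neg q]
    · exact ⟨0, by simp, fun h => absurd h hi⟩
  choose S hS0 hS using h'
  refine ⟨fun c => ∏ k ∈ Finset.range c, S k k, ?_⟩
  intro v1 v2 a b c habc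
  set M := fun u : ℕ → Fin d → ℂ => (Matrix.of fun (i j : Fin d) =>
    if (i : ℕ) < a then v1 (i : ℕ) j
    else if (i : ℕ) < a + b then v2 ((i : ℕ) - a) j
    else u ((i : ℕ) - a - b) j) with hM
  change (M w).det = _ * (M v).det
  set T : ℕ → ℕ → ℂ := fun i j => if i < a + b then (if i = j then 1 else 0)
    else if j < a + b then 0 else S (i - a - b) (j - a - b) with hT
  let T' : Matrix (Fin d) (Fin d) ℂ := Matrix.of fun i j => T i j
  have hmul : M w = T' * M v := by
    ext i j
    rw [Matrix.mul_apply]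
    let N : ℕ → ℂ := fun k => if k < a then v1 k j
      else if k < a + b then v2 (k - a) j else v (k - a - b) j
    have e : ∑ k, T' i k * M v k j = ∑ k ∈ Finset.range d, T i k * N k := by
      rw [Finset.sum_range]
      rfl
    rw [e]
    by_cases hi : (i : ℕ) < a + b
    · rw [Finset.sum_eq_single (i : ℕ)]
      · simp only [hT, hi, if_true, one_mul, hM, N, Matrix.of_apply]
      · intro k _ hk
        simp [hT, hi, hk.symm]
      · intro hk
        simp at hk
    · obtain ⟨n, hn⟩ : ∃ n, (i : ℕ) = a + b + n := ⟨i - (a + b), by omega⟩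
      have hn' : (i : ℕ) - a - b = n := by omega
      have hidx : ∀ k, a + b + k - a - b = k := by intro k; omega
      have hlt := i.2
      rw [show Finset.range d = Finset.range (a + b + c) by rw [habc],
        Finset.sum_range_add, Finset.sum_eq_zero, zero_add]
      · have e1 : ∀ k, T i (a + b + k) * N (a + b + k) = S n k * v k j := by
          intro k
          have q1 : ¬ (a + b + k < a) := by omega
          have q2 : ¬ (a + b + k < a + b) := by omega
          simp only [hT, N, if_neg hi, if_neg q1, if_neg q2, hn', hidx]
        simp only [e1]
        have q1 : ¬ ((i : ℕ) < a) := by omega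
        simp only [hM, Matrix.of_apply, if_neg hi, if_neg q1, hn']
        rw [hS n (by omega), Finset.sum_apply]
        simp only [Pi.smul_apply, smul_eq_mul]
        apply Finset.sum_subset
        · intro k hk
          simp at hk ⊢
          omega
        · intro k _ hk
          simp at hk
          rw [hS0 n k (by omega), zero_mul]
      · intro k hk
        have := Finset.mem_range.mp hk
        simp only [hT, if_neg hi, if_pos this, zero_mul]
  rw [hmul, Matrix.det_mul, Matrix.det_of_isLowerTriangular]
  · congr 1
    have e : ∏ i, T' i i = ∏ k ∈ Finset.range d, T k k := by
      rw [Finset.prod_range]; rfl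
    rw [e, ← habc, Finset.prod_range_add, Finset.prod_eq_one, one_mul]
    · apply Finset.prod_congr rfl
      intro k _
      have q2 : ¬ (a + b + k < a + b) := by omega
      have hidx : a + b + k - a - b = k := by omega
      simp only [hT, if_neg q2, hidx]
    · intro k hk
      have := Finset.mem_range.mp hk
      simp only [hT, if_pos this, if_true]
  · intro i j hij
    have hij' : (i : ℕ) < j := by simpa using hij
    change T i j = 0
    simp only [hT]
    split_ifs with q1 q2 q3
    · omega
    · rfl
    · rfl
    · apply hS0; omega

lemma step_inj {d c m : ℕ} (hm : c + m + 1 = d) (v1 v2 g : ℕ → Fin d → ℂ)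
    (hg : ∀ a b, a + b + c = d → spn v1 a ⊔ spn v2 b ⊔ spn g c = ⊤)
    {x : Fin d → ℂ} (hx : x ∈ spn v2 m)
    (h0 : ∀ a b, a + b = m → 1 ≤ a → wedgeDet d a b v1 v2 (Function.update g c x) = 0) :
    x = 0 := by
  have key : ∀ i ≤ m, x ∈ spn v2 (m - i) := by
    intro i
    induction i with
    | zero => intro _; exact hx
    | succ i ih =>
      intro hi
      have hxi := ih (by omega)
      obtain ⟨k, hk⟩ : ∃ k, m - i = k + 1 := ⟨m - i - 1, by omega⟩
      have hk' : m - (i + 1) = k := by omega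
      rw [hk'] 
      rw [hk, spn_succ, Submodule.mem_sup] at hxi
      obtain ⟨y, hy, z, hz, hyz⟩ := hxi
      obtain ⟨t, rfl⟩ := Submodule.mem_span_singleton.mp hz
      by_cases ht : t = 0
      · rw [ht, zero_smul, add_zero] at hyz
        rwa [← hyz]
      · exfalso
        have hD := h0 (i + 1) k (by omega) (by omega)
        have : wedgeDet d (i + 1) k v1 v2 (Function.update g c x) ≠ 0 := by
          rw [wedge_ne_zero_iff (c := c + 1) (by omega)]
          rw [eq_top_iff, ← hg (i + 1) (k + 1) (by omega)]
          have hgc : spn g c ≤ spn (Function.update g c x) (c + 1) := by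
            apply spn_le
            intro p hp
            have := mem_spn (Function.update g c x) (show p < c + 1 by omega)
            rwa [Function.update_of_ne (by omega)] at this
          have hxc : x ∈ spn (Function.update g c x) (c + 1) := by
            have := mem_spn (Function.update g c x) (show c < c + 1 by omega)
            rwa [Function.update_self] at this
          refine sup_le (sup_le ?_ ?_) ?_
          · exact le_sup_left.trans le_sup_left
          · rw [spn_succ]
            apply sup_le (le_sup_right.trans le_sup_left)
            rw [Submodule.span_singleton_le_iff_mem]
            have e : v2 k = t⁻¹ • (x - y) := by
              rw [← hyz, add_sub_cancel_left, smul_smul, inv_mul_cancel₀ ht, one_smul]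
            rw [e]
            apply Submodule.smul_mem
            apply Submodule.sub_mem
            · exact Submodule.mem_sup_right hxc
            · exact Submodule.mem_sup_left (Submodule.mem_sup_right hy)
          · exact hgc.trans le_sup_right
        exact this hD
  have := key m le_rfl
  rw [Nat.sub_self, spn_zero] at this
  simpa using this

lemma step_surj {d c m : ℕ} (hm : c + m + 1 = d) (v1 v2 g : ℕ → Fin d → ℂ)
    (hg : ∀ a b, a + b + c = d → spn v1 a ⊔ spn v2 b ⊔ spn g c = ⊤)
    (hrk : Module.finrank ℂ (spn v2 m) = m) (t : ℕ → ℂ) :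
    ∃ x ∈ spn v2 m, ∀ a b, a + b = m → 1 ≤ a →
      wedgeDet d a b v1 v2 (Function.update g c x) = t a := by
  let L : spn v2 m →ₗ[ℂ] (Fin m → ℂ) :=
    { toFun := fun x i => wedgeDet d (i + 1) (m - 1 - i) v1 v2 (Function.update g c x)
      map_add' := by
        intro x y
        ext i
        have := i.2
        simp only [Submodule.coe_add, Pi.add_apply]
        exact wedge_update_add (by omega) v1 v2 g _ _
      map_smul' := by
        intro s x
        ext i
        have := i.2
        simp only [Submodule.coe_smul, Pi.smul_apply, smul_eq_mul, RingHom.id_apply]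
        exact wedge_update_smul (by omega) v1 v2 g _ _ }
  have hL : ∀ x i, L x i = wedgeDet d (i + 1) (m - 1 - i) v1 v2 (Function.update g c x) :=
    fun x i => rfl
  have hinj : Function.Injective L := by
    rw [← LinearMap.ker_eq_bot, LinearMap.ker_eq_bot']
    intro x hx
    have := step_inj hm v1 v2 g hg x.2 (by
      intro a b hab ha
      have := congrFun hx ⟨a - 1, by omega⟩
      rw [hL] at this
      simp only [Pi.zero_apply] at this
      rw [show a - 1 + 1 = a by omega, show m - 1 - (a - 1) = b by omega] at this
      exact this)
    exact Subtype.ext this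
  have hsurj := (LinearMap.injective_iff_surjective_of_finrank_eq_finrank
    (by rw [hrk]; simp)).mp hinj
  obtain ⟨x, hx⟩ := hsurj (fun i => t (i + 1))
  refine ⟨x, x.2, ?_⟩
  intro a b hab ha
  have := congrFun hx ⟨a - 1, by omega⟩
  rw [hL] at this
  simp only at this
  rw [show a - 1 + 1 = a by omega, show m - 1 - (a - 1) = b by omega] at this
  exact this

lemma finrank_spn_le {d : ℕ} (v : ℕ → Fin d → ℂ) (k : ℕ) :
    Module.finrank ℂ (spn v k) ≤ k := by
  induction k with
  | zero => rw [spn_zero]; simp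
  | succ k ih =>
    rw [spn_succ]
    have := Submodule.finrank_add_le_finrank_add_finrank (spn v k) (Submodule.span ℂ {v k})
    have h2 := finrank_span_le_card (R := ℂ) ({v k} : Set (Fin d → ℂ))
    simp at h2
    omega

lemma wedge_zero_update {d c m : ℕ} (hm : c + m + 1 = d) (v1 v2 g : ℕ → Fin d → ℂ)
    {x : Fin d → ℂ} (hx : x ∈ spn v2 m) :
    wedgeDet d 0 m v1 v2 (Function.update g c x) = 0 := by
  by_contra hne
  have h := (wedge_ne_zero_iff (c := c + 1) (by omega) v1 v2 _).mp hne
  have hle : (⊤ : Submodule ℂ (Fin d → ℂ)) ≤ spn v2 m ⊔ spn g c := by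
    rw [← h, spn_zero, bot_sup_eq]
    apply sup_le le_sup_left
    apply spn_le
    intro i hi
    by_cases hic : i = c
    · rw [hic, Function.update_self]
      exact Submodule.mem_sup_left hx
    · rw [Function.update_of_ne hic]
      exact Submodule.mem_sup_right (mem_spn g (by omega))
  have h1 := Submodule.finrank_mono hle
  have h2 := Submodule.finrank_add_le_finrank_add_finrank (spn v2 m) (spn g c)
  have h3 := finrank_spn_le v2 m
  have h4 := finrank_spn_le g c
  rw [finrank_top] at h1
  simp at h1
  omega

/-- The triple ratio computed with explicit bases. -/
def rat (d : ℕ) (j : ℕ × ℕ × ℕ) (v1 v2 v3 : ℕ → Fin d → ℂ) : ℂ :=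
  (wedgeDet d (j.1 + 1) j.2.1 v1 v2 v3 * wedgeDet d j.1 (j.2.1 - 1) v1 v2 v3 *
      wedgeDet d (j.1 - 1) (j.2.1 + 1) v1 v2 v3) /
    (wedgeDet d (j.1 - 1) j.2.1 v1 v2 v3 * wedgeDet d j.1 (j.2.1 + 1) v1 v2 v3 *
      wedgeDet d (j.1 + 1) (j.2.1 - 1) v1 v2 v3)

lemma rat_succ (d a b n : ℕ) (v1 v2 v3 : ℕ → Fin d → ℂ) :
    rat d (a + 1, b + 1, n) v1 v2 v3 =
      (wedgeDet d (a + 2) (b + 1) v1 v2 v3 * wedgeDet d (a + 1) b v1 v2 v3 *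
      wedgeDet d a (b + 2) v1 v2 v3) /
    (wedgeDet d a (b + 1) v1 v2 v3 * wedgeDet d (a + 1) (b + 2) v1 v2 v3 *
      wedgeDet d (a + 2) b v1 v2 v3) := rfl

lemma memB_cases {d : ℕ} {j : ℕ × ℕ × ℕ} (h : memB d j) :
    ∃ a b c, j = (a + 1, b + 1, c + 1) ∧ a + b + c + 3 = d := by
  obtain ⟨j1, j2, j3⟩ := j
  obtain ⟨h1, h2, h3, h4⟩ := h
  simp only at h1 h2 h3 h4
  refine ⟨j1 - 1, j2 - 1, j3 - 1, ?_, by omega⟩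
  rw [Nat.sub_add_cancel h1, Nat.sub_add_cancel h2, Nat.sub_add_cancel h3]

lemma core_unique {d : ℕ} (v1 v2 g g' : ℕ → Fin d → ℂ) (h0 : g 0 = g' 0)
    (hdiff : ∀ c < d, g' c - g c ∈ spn v2 (d - c - 1))
    (hg : ∀ a b c, a + b + c = d → wedgeDet d a b v1 v2 g ≠ 0)
    (hr : ∀ j, memB d j → rat d j v1 v2 g = rat d j v1 v2 g') :
    ∀ c < d, g c = g' c := by
  intro c
  induction c using Nat.strong_induction_on with
  | _ c ih =>
    intro hc
    rcases Nat.eq_zero_or_pos c with rfl | hcpos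
    · exact h0
    obtain ⟨n, rfl⟩ : ∃ n, c = n + 1 := ⟨c - 1, by omega⟩
    obtain ⟨m, hm⟩ : ∃ m, n + 1 + m + 1 = d := ⟨d - (n + 1) - 1, by omega⟩
    have hx := hdiff (n + 1) hc
    rw [show d - (n + 1) - 1 = m by omega] at hx
    set x := g' (n + 1) - g (n + 1) with hxdef
    have low : ∀ a b k, a + b + k = d → k ≤ n + 1 →
        wedgeDet d a b v1 v2 g = wedgeDet d a b v1 v2 g' := by
      intro a b k hk hkn
      exact wedge_congr hk v1 v2 fun i hi => ih i (by omega) (by omega)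
    have hadd : ∀ a b, a + b = m → wedgeDet d a b v1 v2 g' =
        wedgeDet d a b v1 v2 g + wedgeDet d a b v1 v2 (Function.update g (n + 1) x) := by
      intro a b hab
      have e1 : wedgeDet d a b v1 v2 g' =
          wedgeDet d a b v1 v2 (Function.update g (n + 1) (g (n + 1) + x)) := by
        apply wedge_congr (c := n + 2) (by omega)
        intro i hi
        by_cases hin : i = n + 1
        · rw [hin, Function.update_self, hxdef, add_sub_cancel]
        · rw [Function.update_of_ne hin, ih i (by omega) (by omega)]
      rw [e1, wedge_update_add (by omega), Function.update_eq_self]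
    have heq : ∀ a, ∀ b, a + b = m → wedgeDet d a b v1 v2 g = wedgeDet d a b v1 v2 g' := by
      intro a
      induction a with
      | zero =>
        intro b hb
        rw [hadd 0 b hb, show b = m by omega, wedge_zero_update hm v1 v2 g hx, add_zero]
      | succ a iha =>
        intro b hb
        have hj := hr (a + 1, b + 1, n + 1) ⟨by simp, by simp, by simp, by simp; omega⟩
        rw [rat_succ, rat_succ, ← iha (b + 1) (by omega), ← low (a + 2) (b + 1) n (by omega) (by omega),
          ← low a (b + 2) (n + 1) (by omega) (by omega),
          ← low (a + 1) (b + 2) n (by omega) (by omega),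
          ← low (a + 2) b (n + 1) (by omega) (by omega)] at hj
        have n1 := hg (a + 2) (b + 1) n (by omega)
        have n2 := hg a (b + 2) (n + 1) (by omega)
        have n3 := hg a (b + 1) (n + 2) (by omega)
        have n4 := hg (a + 1) (b + 2) n (by omega)
        have n5 := hg (a + 2) b (n + 1) (by omega)
        rw [div_left_inj' (mul_ne_zero (mul_ne_zero n3 n4) n5)] at hj
        exact mul_left_cancel₀ n1 (mul_right_cancel₀ n2 hj)
    have hx0 : x = 0 := by
      apply step_inj hm v1 v2 g ?_ hx
      · intro a b hab _
        have := hadd a b hab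
        rw [heq a b hab] at this
        simpa using this
      · intro a b hab
        exact (wedge_ne_zero_iff hab v1 v2 g).mp (hg a b _ hab)
    exact (sub_eq_zero.mp hx0).symm

lemma core_exists {d : ℕ} (v1 v2 e : ℕ → Fin d → ℂ) (zz : ℕ × ℕ × ℕ → ℂ)
    (hzz : ∀ j, memB d j → zz j ≠ 0) (g0 : Fin d → ℂ)
    (hrk : ∀ m ≤ d, Module.finrank ℂ (spn v2 m) = m)
    (hgen0 : ∀ a b, a + b = d → spn v1 a ⊔ spn v2 b = ⊤)
    (he : ∀ c < d, spn v2 (d - c) ≤ spn v2 (d - c - 1) ⊔ Submodule.span ℂ {e c})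
    (hg0 : g0 - e 0 ∈ spn v2 (d - 1))
    (hg0' : ∀ a b, a + b + 1 = d → spn v1 a ⊔ spn v2 b ⊔ Submodule.span ℂ {g0} = ⊤) :
    ∀ n, n + 1 ≤ d → ∃ g : ℕ → Fin d → ℂ, g 0 = g0 ∧
      (∀ c < n + 1, g c - e c ∈ spn v2 (d - c - 1)) ∧
      (∀ a b c, c ≤ n + 1 → a + b + c = d → wedgeDet d a b v1 v2 g ≠ 0) ∧
      ∀ j, memB d j → j.2.2 ≤ n → rat d j v1 v2 g = zz j := by
  intro n
  induction n with
  | zero =>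
    intro hd
    refine ⟨fun _ => g0, rfl, ?_, ?_, ?_⟩
    · intro c hc
      rw [show c = 0 by omega]
      exact hg0
    · intro a b c hc habc
      rw [wedge_ne_zero_iff habc]
      obtain rfl | rfl : c = 0 ∨ c = 1 := by omega
      · rw [spn_zero, sup_bot_eq]
        exact hgen0 a b (by omega)
      · rw [spn_succ, spn_zero, bot_sup_eq]
        exact hg0' a b habc
    · intro j hj hj3
      have := hj.2.2.1
      omega
  | succ n ih =>
    intro hd
    obtain ⟨g, hgz, hgd, hgn, hgr⟩ := ih (by omega)
    obtain ⟨m, hm⟩ : ∃ m, n + 1 + m + 1 = d := ⟨d - (n + 1) - 1, by omega⟩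
    set D := fun a b => wedgeDet d a b v1 v2 g with hD
    set g1 := Function.update g (n + 1) (e (n + 1)) with hg1
    let t : ℕ → ℂ := fun a => Nat.rec (wedgeDet d 0 m v1 v2 g1) (fun a ta =>
      zz (a + 1, m - (a + 1) + 1, n + 1) *
        (ta * D (a + 1) (m - (a + 1) + 2) * D (a + 2) (m - (a + 1))) /
        (D (a + 2) (m - (a + 1) + 1) * D a (m - (a + 1) + 2))) a
    have ht0 : t 0 = wedgeDet d 0 m v1 v2 g1 := rfl
    have hts : ∀ a b, a + 1 + b = m → t (a + 1) = zz (a + 1, b + 1, n + 1) *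
        (t a * D (a + 1) (b + 2) * D (a + 2) b) / (D (a + 2) (b + 1) * D a (b + 2)) := by
      intro a b hab
      have : m - (a + 1) = b := by omega
      rw [← this]
    have hDne : ∀ a b c, c ≤ n + 1 → a + b + c = d → D a b ≠ 0 := hgn
    have htne : ∀ a ≤ m, t a ≠ 0 := by
      intro a
      induction a with
      | zero =>
        intro _
        rw [ht0, wedge_ne_zero_iff (c := n + 2) (by omega), eq_top_iff,
          ← (wedge_ne_zero_iff (c := n + 1) (by omega) v1 v2 g).mp
            (hgn 0 (m + 1) (n + 1) le_rfl (by omega))]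
        have hgl : spn g (n + 1) ≤ spn g1 (n + 2) := by
          apply spn_le
          intro i hi
          have := mem_spn g1 (show i < n + 2 by omega)
          rwa [hg1, Function.update_of_ne (by omega)] at this
        have hel : e (n + 1) ∈ spn g1 (n + 2) := by
          have := mem_spn g1 (show n + 1 < n + 2 by omega)
          have h2 : g1 (n + 1) = e (n + 1) := by rw [hg1, Function.update_self]
          rwa [h2] at this
        have hen := he (n + 1) (by omega)
        rw [show d - (n + 1) - 1 = m by omega, show d - (n + 1) = m + 1 by omega] at hen
        refine sup_le (sup_le (le_sup_left.trans le_sup_left) (hen.trans (sup_le ?_ ?_))) ?_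
        · exact le_sup_right.trans le_sup_left
        · rw [Submodule.span_singleton_le_iff_mem]
          exact Submodule.mem_sup_right hel
        · exact hgl.trans le_sup_right
      | succ a iha =>
        intro ha
        obtain ⟨b, hb⟩ : ∃ b, a + 1 + b = m := ⟨m - (a + 1), by omega⟩
        rw [hts a b hb]
        refine div_ne_zero (mul_ne_zero (hzz _ ⟨by simp, by simp, by simp, by simp; omega⟩)
          (mul_ne_zero (mul_ne_zero (iha (by omega)) ?_) ?_)) (mul_ne_zero ?_ ?_)
        · exact hDne _ _ n (by omega) (by omega)
        · exact hDne _ _ (n + 1) (by omega) (by omega)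
        · exact hDne _ _ n (by omega) (by omega)
        · exact hDne _ _ (n + 1) (by omega) (by omega)
    obtain ⟨x, hx, hxt⟩ := step_surj hm v1 v2 g
      (fun a b hab => (wedge_ne_zero_iff hab v1 v2 g).mp (hgn a b (n + 1) le_rfl hab))
      (hrk m (by omega)) (fun a => t a - wedgeDet d a (m - a) v1 v2 g1)
    set g2 := Function.update g (n + 1) (e (n + 1) + x) with hg2
    have hnew : ∀ a b, a + b = m → wedgeDet d a b v1 v2 g2 = t a := by
      intro a b hab
      rw [hg2, wedge_update_add (by omega)]
      rcases Nat.eq_zero_or_pos a with rfl | ha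
      · rw [show b = m by omega, wedge_zero_update hm v1 v2 g hx, add_zero, ht0]
      · rw [hxt a b hab ha, show m - a = b by omega]
        ring
    have hold : ∀ a b c, c ≤ n + 1 → a + b + c = d → wedgeDet d a b v1 v2 g2 = D a b := by
      intro a b c hc habc
      apply wedge_congr habc
      intro i hi
      rw [hg2, Function.update_of_ne (by omega)]
    refine ⟨g2, ?_, ?_, ?_, ?_⟩
    · rw [hg2, Function.update_of_ne (by omega), hgz]
    · intro c hc
      by_cases hcn : c = n + 1
      · rw [hcn, hg2, Function.update_self, add_sub_cancel_left, show d - (n + 1) - 1 = m by omega]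
        exact hx
      · rw [hg2, Function.update_of_ne hcn]
        exact hgd c (by omega)
    · intro a b c hc habc
      by_cases hcn : c = n + 2
      · rw [hnew a b (by omega)]
        exact htne a (by omega)
      · rw [hold a b c (by omega) habc]
        exact hDne a b c (by omega) habc
    · intro j hj hj3
      obtain ⟨a, b, c, rfl, habc⟩ := memB_cases hj
      simp only at hj3
      by_cases hcn : c = n
      · subst hcn
        rw [rat_succ, hnew (a + 1) b (by omega), hnew a (b + 1) (by omega),
          hold (a + 2) (b + 1) c (by omega) (by omega),
          hold a (b + 2) (c + 1) (by omega) (by omega),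
          hold (a + 1) (b + 2) c (by omega) (by omega),
          hold (a + 2) b (c + 1) (by omega) (by omega), hts a b (by omega)]
        have n1 := hDne (a + 2) (b + 1) c (by omega) (by omega)
        have n2 := hDne a (b + 2) (c + 1) (by omega) (by omega)
        have n3 := htne a (by omega)
        have n4 := hDne (a + 1) (b + 2) c (by omega) (by omega)
        have n5 := hDne (a + 2) b (c + 1) (by omega) (by omega)
        field_simp
      · rw [← hgr (a + 1, b + 1, c + 1) hj (by simp only; omega), rat_succ, rat_succ,
          hold (a + 1) b (c + 2) (by omega) (by omega),
          hold a (b + 1) (c + 2) (by omega) (by omega),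
          hold (a + 2) (b + 1) c (by omega) (by omega),
          hold a (b + 2) (c + 1) (by omega) (by omega),
          hold (a + 1) (b + 2) c (by omega) (by omega),
          hold (a + 2) b (c + 1) (by omega) (by omega)]

lemma sup_span_eq {d : ℕ} {A B : Submodule ℂ (Fin d → ℂ)} (hAB : A ≤ B)
    (hrk : Module.finrank ℂ B = Module.finrank ℂ A + 1) {x : Fin d → ℂ} (hx : x ∈ B)
    (hx' : x ∉ A) : B = A ⊔ Submodule.span ℂ {x} := by
  symm
  apply Submodule.eq_of_le_of_finrank_le
  · exact sup_le hAB (by rwa [Submodule.span_singleton_le_iff_mem])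
  · have hlt : A < A ⊔ Submodule.span ℂ {x} := by
      refine lt_of_le_of_ne le_sup_left fun h => hx' ?_
      rw [h]
      exact Submodule.mem_sup_right (Submodule.mem_span_singleton_self x)
    have := Submodule.finrank_lt_finrank_of_lt hlt
    omega

lemma adapted_of {d : ℕ} {F : ℕ → Submodule ℂ (Fin d → ℂ)} (hF : IsCompleteFlag d F)
    {v : ℕ → Fin d → ℂ} (hv : ∀ c < d, v c ∈ F (c + 1) ∧ v c ∉ F c) :
    IsAdaptedBasis d F v := by
  intro k
  change k ≤ d → F k = spn v k
  induction k with
  | zero =>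
    intro _
    rw [spn_zero, ← Submodule.finrank_eq_zero (R := ℂ)]
    exact hF.2 0 (by omega)
  | succ k ih =>
    intro hk
    rw [spn_succ, ← ih (by omega)]
    apply sup_span_eq (hF.1 (Nat.le_succ k)) _ (hv k hk).1 (hv k hk).2
    rw [hF.2 _ hk, hF.2 k (by omega)]

lemma exists_adapted {d : ℕ} {F : ℕ → Submodule ℂ (Fin d → ℂ)} (hF : IsCompleteFlag d F) :
    ∃ v, IsAdaptedBasis d F v := by
  have : ∀ c, ∃ x : Fin d → ℂ, c < d → x ∈ F (c + 1) ∧ x ∉ F c := by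
    intro c
    by_cases hc : c < d
    · have hn : ¬ F (c + 1) ≤ F c := by
        intro h
        have := Submodule.finrank_mono h
        rw [hF.2 _ hc, hF.2 c (by omega)] at this
        omega
      obtain ⟨x, hx, hx'⟩ := SetLike.not_le_iff_exists.mp hn
      exact ⟨x, fun _ => ⟨hx, hx'⟩⟩
    · exact ⟨0, fun h => absurd h hc⟩
  choose v hv using this
  exact ⟨v, adapted_of hF hv⟩

lemma flagBasis_spec {d : ℕ} {F : ℕ → Submodule ℂ (Fin d → ℂ)}
    (h : ∃ v, IsAdaptedBasis d F v) : IsAdaptedBasis d F (flagBasis d F) :=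
  Classical.epsilon_spec h

lemma genPos_wedge {d : ℕ} {F1 F2 F3 : ℕ → Submodule ℂ (Fin d → ℂ)}
    {v1 v2 v3 : ℕ → Fin d → ℂ} (h1 : IsAdaptedBasis d F1 v1) (h2 : IsAdaptedBasis d F2 v2)
    (h3 : IsAdaptedBasis d F3 v3) :
    GenPos3 d F1 F2 F3 ↔ ∀ a b c, a + b + c = d → wedgeDet d a b v1 v2 v3 ≠ 0 := by
  have key : ∀ a b c, a + b + c = d →
      (F1 a ⊔ F2 b ⊔ F3 c = ⊤ ↔ wedgeDet d a b v1 v2 v3 ≠ 0) := by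
    intro a b c habc
    rw [wedge_ne_zero_iff habc, h1 a (by omega), h2 b (by omega), h3 c (by omega)]
    rfl
  constructor
  · intro h a b c habc
    exact (key a b c habc).mp (h a b c habc)
  · intro h a b c habc
    exact (key a b c habc).mpr (h a b c habc)

lemma tripleRatio_eq {d : ℕ} {F1 F2 F3 : ℕ → Submodule ℂ (Fin d → ℂ)}
    (h1 : IsCompleteFlag d F1) (h2 : IsCompleteFlag d F2) {w : ℕ → Fin d → ℂ}
    (hw : IsAdaptedBasis d F3 w) (hgen : GenPos3 d F1 F2 F3) {j : ℕ × ℕ × ℕ} (hj : memB d j) :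
    tripleRatio d j F1 F2 F3 = rat d j (flagBasis d F1) (flagBasis d F2) w := by
  change rat d j _ _ (flagBasis d F3) = _
  have a1 := flagBasis_spec (exists_adapted h1)
  have a2 := flagBasis_spec (exists_adapted h2)
  have a3 := flagBasis_spec ⟨w, hw⟩
  have hne := (genPos_wedge a1 a2 a3).mp hgen
  have hne' := (genPos_wedge a1 a2 hw).mp hgen
  obtain ⟨lam, hlam⟩ := wedge_change (v := w) (w := flagBasis d F3) (by
    intro i hi
    have e : spn w (i + 1) = spn (flagBasis d F3) (i + 1) :=
      (hw (i + 1) hi).symm.trans (a3 (i + 1) hi)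
    rw [e]
    exact mem_spn _ (Nat.lt_succ_self i))
  generalize flagBasis d F1 = v1 at *
  generalize flagBasis d F2 = v2 at *
  generalize flagBasis d F3 = v3 at *
  have hl : ∀ c ≤ d, lam c ≠ 0 := by
    intro c hc h0
    have := hlam v1 v2 (d - c) 0 c (by omega)
    rw [h0, zero_mul] at this
    exact hne _ _ c (by omega) this
  obtain ⟨a, b, c, rfl, habc⟩ := memB_cases hj
  rw [rat_succ, rat_succ,
    hlam v1 v2 (a + 1) b (c + 2) (by omega),
    hlam v1 v2 a (b + 1) (c + 2) (by omega),
    hlam v1 v2 (a + 2) (b + 1) c (by omega),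
    hlam v1 v2 a (b + 2) (c + 1) (by omega),
    hlam v1 v2 (a + 1) (b + 2) c (by omega),
    hlam v1 v2 (a + 2) b (c + 1) (by omega)]
  have l0 := hl c (by omega)
  have l1 := hl (c + 1) (by omega)
  have l2 := hl (c + 2) (by omega)
  have n1 := hne' a (b + 1) (c + 2) (by omega)
  have n2 := hne' (a + 1) (b + 2) c (by omega)
  have n3 := hne' (a + 2) b (c + 1) (by omega)
  field_simp

lemma exists_double_adapted {d : ℕ} {F2 F3 : ℕ → Submodule ℂ (Fin d → ℂ)}
    (h2 : IsCompleteFlag d F2) (h3 : IsCompleteFlag d F3)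
    (ht : ∀ b c, b + c = d → F2 b ⊔ F3 c = ⊤) :
    ∃ e : ℕ → Fin d → ℂ, (∀ c < d, e c ∈ F3 (c + 1) ∧ e c ∉ F3 c) ∧
      ∀ c < d, e c ∈ F2 (d - c) ∧ e c ∉ F2 (d - c - 1) := by
  have hbot : ∀ b c, b + c = d → F2 b ⊓ F3 c = ⊥ := by
    intro b c hbc
    have := Submodule.finrank_sup_add_finrank_inf_eq (F2 b) (F3 c)
    rw [ht b c hbc, h2.2 b (by omega), h3.2 c (by omega), finrank_top] at this
    simp at this
    rw [← Submodule.finrank_eq_zero (R := ℂ)]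
    omega
  have : ∀ c, ∃ x : Fin d → ℂ, c < d → x ≠ 0 ∧ x ∈ F2 (d - c) ∧ x ∈ F3 (c + 1) := by
    intro c
    by_cases hc : c < d
    · have := Submodule.finrank_sup_add_finrank_inf_eq (F2 (d - c)) (F3 (c + 1))
      rw [h2.2 _ (by omega), h3.2 _ (by omega)] at this
      have hle := Submodule.finrank_le (F2 (d - c) ⊔ F3 (c + 1))
      simp at hle
      have hne : F2 (d - c) ⊓ F3 (c + 1) ≠ ⊥ := by
        intro h
        rw [h, finrank_bot] at this
        omega
      obtain ⟨x, hx, hx0⟩ := Submodule.exists_mem_ne_zero_of_ne_bot hne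
      exact ⟨x, fun _ => ⟨hx0, hx.1, hx.2⟩⟩
    · exact ⟨0, fun h => absurd h hc⟩
  choose e he using this
  refine ⟨e, fun c hc => ⟨(he c hc).2.2, fun h => (he c hc).1 ?_⟩,
    fun c hc => ⟨(he c hc).2.1, fun h => (he c hc).1 ?_⟩⟩
  · have : e c ∈ F2 (d - c) ⊓ F3 c := ⟨(he c hc).2.1, h⟩
    rw [hbot _ _ (by omega)] at this
    simpa using this
  · have : e c ∈ F2 (d - c - 1) ⊓ F3 (c + 1) := ⟨h, (he c hc).2.2⟩
    rw [hbot _ _ (by omega)] at this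
    simpa using this

lemma exists_matrix {d : ℕ} {e : ℕ → Fin d → ℂ} (he : spn e d = ⊤) (g : ℕ → Fin d → ℂ) :
    ∃ u : Matrix (Fin d) (Fin d) ℂ, ∀ c < d, u.mulVec (e c) = g c := by
  have hs : ⊤ ≤ Submodule.span ℂ (Set.range fun i : Fin d => e i) := by
    rw [← he]
    exact spn_le fun i hi => Submodule.subset_span ⟨⟨i, hi⟩, rfl⟩
  have hli : LinearIndependent ℂ (fun i : Fin d => e i) :=
    linearIndependent_of_top_le_span_of_card_eq_finrank hs (by simp)
  let b := Module.Basis.mk hli hs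
  refine ⟨LinearMap.toMatrix' (b.constr ℂ fun i : Fin d => g i), ?_⟩
  intro c hc
  rw [LinearMap.toMatrix'_mulVec]
  have := b.constr_basis ℂ (fun i : Fin d => g i) ⟨c, hc⟩
  rw [Module.Basis.mk_apply] at this
  exact this

lemma nilp_step {d : ℕ} {N : Matrix (Fin d) (Fin d) ℂ} (hN : IsNilpotent N)
    {A : Submodule ℂ (Fin d → ℂ)} {x : Fin d → ℂ} (hA : ∀ y ∈ A, N.mulVec y ∈ A)
    (hx : N.mulVec x ∈ A ⊔ Submodule.span ℂ {x}) : N.mulVec x ∈ A := by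
  by_cases hxA : x ∈ A
  · exact hA x hxA
  obtain ⟨y, hy, z, hz, hyz⟩ := Submodule.mem_sup.mp hx
  obtain ⟨t, rfl⟩ := Submodule.mem_span_singleton.mp hz
  by_cases ht : t = 0
  · rw [← hyz, ht, zero_smul, add_zero]
    exact hy
  exfalso
  have hk : ∀ k : ℕ, (N ^ k).mulVec x - t ^ k • x ∈ A := by
    intro k
    induction k with
    | zero => simp
    | succ k ih =>
      have e : (N ^ (k + 1)).mulVec x - t ^ (k + 1) • x =
          N.mulVec ((N ^ k).mulVec x - t ^ k • x) + t ^ k • y := by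
        rw [Matrix.mulVec_sub, Matrix.mulVec_smul, ← hyz, Matrix.mulVec_mulVec, ← pow_succ',
          smul_add, smul_smul, ← pow_succ]
        abel
      rw [e]
      exact A.add_mem (hA _ ih) (A.smul_mem _ hy)
  obtain ⟨n, hn⟩ := hN
  have := hk n
  rw [hn, Matrix.zero_mulVec, zero_sub, Submodule.neg_mem_iff] at this
  exact hxA ((A.smul_mem_iff (pow_ne_zero n ht)).mp this)

lemma unipotent_injective {d : ℕ} {u : Matrix (Fin d) (Fin d) ℂ} (hu : IsNilpotent (u - 1)) :
    Function.Injective u.mulVecLin := by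
  have h := hu.isUnit_one_add
  rw [add_sub_cancel] at h
  exact Matrix.mulVec_injective_of_isUnit h

lemma adapted_flagMap {d : ℕ} (u : Matrix (Fin d) (Fin d) ℂ)
    {F : ℕ → Submodule ℂ (Fin d → ℂ)} {e : ℕ → Fin d → ℂ} (h : IsAdaptedBasis d F e) :
    IsAdaptedBasis d (flagMap d u F) (fun c => u.mulVec (e c)) := by
  intro k hk
  unfold flagMap
  rw [h k hk, Submodule.map_span, Set.image_image]
  rfl

theorem statement_11 (d : ℕ) (hd : 2 ≤ d) (F1 F2 F3 : ℕ → Submodule ℂ (Fin d → ℂ))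
    (h1 : IsCompleteFlag d F1) (h2 : IsCompleteFlag d F2) (h3 : IsCompleteFlag d F3)
    (hgen : GenPos3 d F1 F2 F3)
    (z : ℕ × ℕ × ℕ → ℂ) (hz : ∀ j, memB d j → z j ≠ 0)
    (l : Submodule ℂ (Fin d → ℂ)) (hl : Module.finrank ℂ ↥l = 1)
    (hlgen : ∀ k, 1 ≤ k → k ≤ d → F2 (k - 1) ⊔ F1 (d - k) ⊔ l = ⊤) :
    ∃! u : Matrix (Fin d) (Fin d) ℂ, IsNilpotent (u - 1) ∧
      flagMap d u F2 = F2 ∧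
      Submodule.map u.mulVecLin (F3 1) = l ∧
      GenPos3 d F1 F2 (flagMap d u F3) ∧
      ∀ j : ℕ × ℕ × ℕ, memB d j →
        tripleRatio d j F1 F2 (flagMap d u F3) = z j * tripleRatio d j F1 F2 F3 := by
  have a1 := flagBasis_spec (exists_adapted h1)
  have a2 := flagBasis_spec (exists_adapted h2)
  have ht : ∀ b c, b + c = d → F2 b ⊔ F3 c = ⊤ := by
    intro b c hbc
    have := hgen 0 b c (by omega)
    rwa [a1 0 (by omega), show {m : ℕ | m < 0} = ∅ by ext; simp, Set.image_empty,
      Submodule.span_empty, bot_sup_eq] at this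
  obtain ⟨e, he3, he2⟩ := exists_double_adapted h2 h3 ht
  have ae := adapted_of h3 he3
  have hF1 : ∀ k ≤ d, F1 k = spn (flagBasis d F1) k := a1
  have hF2 : ∀ k ≤ d, F2 k = spn (flagBasis d F2) k := a2
  have hF3 : ∀ k ≤ d, F3 k = spn e k := ae
  have hTr : ∀ u : Matrix (Fin d) (Fin d) ℂ, GenPos3 d F1 F2 (flagMap d u F3) →
      ∀ j, memB d j → tripleRatio d j F1 F2 (flagMap d u F3) =
        rat d j (flagBasis d F1) (flagBasis d F2) (fun c => u.mulVec (e c)) :=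
    fun u hu j hj => tripleRatio_eq h1 h2 (adapted_flagMap u ae) hu hj
  have hGen : ∀ u : Matrix (Fin d) (Fin d) ℂ, GenPos3 d F1 F2 (flagMap d u F3) ↔
      ∀ a b c, a + b + c = d → wedgeDet d a b (flagBasis d F1) (flagBasis d F2)
        (fun c => u.mulVec (e c)) ≠ 0 := fun u => genPos_wedge a1 a2 (adapted_flagMap u ae)
  have hT0 : ∀ j, memB d j → tripleRatio d j F1 F2 F3 ≠ 0 := by
    intro j hj
    rw [tripleRatio_eq h1 h2 ae hgen hj]
    have hne := (genPos_wedge a1 a2 ae).mp hgen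
    obtain ⟨a, b, c, rfl, habc⟩ := memB_cases hj
    rw [rat_succ]
    exact div_ne_zero (mul_ne_zero (mul_ne_zero (hne _ _ c (by omega)) (hne _ _ (c + 2) (by omega)))
      (hne _ _ (c + 1) (by omega))) (mul_ne_zero (mul_ne_zero (hne _ _ (c + 2) (by omega))
      (hne _ _ c (by omega))) (hne _ _ (c + 1) (by omega)))
  have hF2top : F2 d = ⊤ := by
    apply Submodule.eq_top_of_finrank_eq
    rw [h2.2 d le_rfl]; simp
  have hF3top : spn e d = ⊤ := by
    rw [← hF3 d le_rfl]
    apply Submodule.eq_top_of_finrank_eq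
    rw [h3.2 d le_rfl]; simp
  have hF2e : ∀ c < d, F2 (d - c) = F2 (d - c - 1) ⊔ Submodule.span ℂ {e c} := by
    intro c hc
    apply sup_span_eq (h2.1 (by omega)) _ (he2 c hc).1 (he2 c hc).2
    rw [h2.2 _ (by omega), h2.2 _ (by omega)]
    omega
  have hl2 : F2 (d - 1) ⊔ l = ⊤ := by
    have := hlgen d (by omega) le_rfl
    rwa [Nat.sub_self, a1 0 (by omega), show {m : ℕ | m < 0} = ∅ by ext; simp, Set.image_empty,
      Submodule.span_empty, sup_bot_eq] at this
  have hl2' : F2 (d - 1) ⊓ l = ⊥ := by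
    have := Submodule.finrank_sup_add_finrank_inf_eq (F2 (d - 1)) l
    rw [hl2, h2.2 _ (by omega), hl, finrank_top] at this
    simp at this
    rw [← Submodule.finrank_eq_zero (R := ℂ)]
    omega
  obtain ⟨g0, hg0l, hg0e⟩ : ∃ g0 ∈ l, g0 - e 0 ∈ F2 (d - 1) := by
    have : e 0 ∈ F2 (d - 1) ⊔ l := by rw [hl2]; trivial
    obtain ⟨y, hy, w, hw, hyw⟩ := Submodule.mem_sup.mp this
    refine ⟨w, hw, ?_⟩
    rw [← hyw, show w - (y + w) = -y by abel]
    exact Submodule.neg_mem _ hy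
  have hg0ne : g0 ≠ 0 := by
    rintro rfl
    rw [zero_sub, Submodule.neg_mem_iff] at hg0e
    exact (he2 0 (by omega)).2 hg0e
  have hlspan : Submodule.span ℂ {g0} = l := by
    apply Submodule.eq_of_le_of_finrank_le
    · rwa [Submodule.span_singleton_le_iff_mem]
    · rw [hl, finrank_span_singleton hg0ne]
  -- necessary conditions on `u`
  have hnec : ∀ u : Matrix (Fin d) (Fin d) ℂ, IsNilpotent (u - 1) → flagMap d u F2 = F2 →
      Submodule.map u.mulVecLin (F3 1) = l →
      u.mulVec (e 0) = g0 ∧ ∀ c < d, u.mulVec (e c) - e c ∈ F2 (d - c - 1) := by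
    intro u hnil hfl hul
    have hpres : ∀ k, ∀ y ∈ F2 k, (u - 1).mulVec y ∈ F2 k := by
      intro k y hy
      rw [Matrix.sub_mulVec, Matrix.one_mulVec]
      apply Submodule.sub_mem _ _ hy
      have h : u.mulVec y ∈ flagMap d u F2 k := ⟨y, hy, rfl⟩
      rwa [hfl] at h
    have hall : ∀ c < d, u.mulVec (e c) - e c ∈ F2 (d - c - 1) := by
      intro c hc
      have := nilp_step hnil (hpres (d - c - 1)) (x := e c) (by
        rw [← hF2e c hc]
        exact hpres _ _ (he2 c hc).1)
      rwa [Matrix.sub_mulVec, Matrix.one_mulVec] at this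
    refine ⟨?_, hall⟩
    have hmem : u.mulVec (e 0) ∈ l := by
      rw [← hul]
      exact ⟨e 0, (he3 0 (by omega)).1, rfl⟩
    have : u.mulVec (e 0) - g0 ∈ F2 (d - 1) ⊓ l := by
      refine ⟨?_, Submodule.sub_mem _ hmem hg0l⟩
      have := Submodule.sub_mem _ (hall 0 (by omega)) hg0e
      rwa [sub_sub_sub_cancel_right] at this
    rw [hl2'] at this
    exact sub_eq_zero.mp (by simpa using this)
  -- existence
  obtain ⟨n, hn⟩ : ∃ n, n + 1 = d := ⟨d - 1, by omega⟩
  obtain ⟨g, hgz, hgd, hgn, hgr⟩ := core_exists (flagBasis d F1) (flagBasis d F2) e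
    (fun j => z j * tripleRatio d j F1 F2 F3) (fun j hj => mul_ne_zero (hz j hj) (hT0 j hj)) g0
    (fun m hm => by rw [← hF2 m hm]; exact h2.2 m hm)
    (fun a b hab => by
      have := hgen a b 0 (by omega)
      rwa [hF1 a (by omega), hF2 b (by omega), hF3 0 (by omega), spn_zero, sup_bot_eq] at this)
    (fun c hc => by
      rw [← hF2 _ (by omega), ← hF2 _ (by omega)]
      exact (hF2e c hc).le)
    (by rw [← hF2 _ (by omega)]; exact hg0e)
    (fun a b hab => by
      have := hlgen (b + 1) (by omega) (by omega)
      rw [Nat.add_sub_cancel, show d - (b + 1) = a by omega, hF1 a (by omega),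
        hF2 b (by omega)] at this
      rw [hlspan, sup_comm (spn (flagBasis d F1) a)]
      exact this)
    n hn.le
  obtain ⟨u, hu⟩ := exists_matrix hF3top g
  have hdown : ∀ k, k + 1 ≤ d → ∀ y ∈ F2 (k + 1), (u - 1).mulVec y ∈ F2 k := by
    intro k
    induction k with
    | zero =>
      intro hk y hy
      have h := hF2e (d - 1) (by omega)
      rw [show d - (d - 1) - 1 = 0 by omega, show d - (d - 1) = 0 + 1 by omega] at h
      rw [h, hF2 0 (by omega), spn_zero, bot_sup_eq] at hy
      obtain ⟨t, rfl⟩ := Submodule.mem_span_singleton.mp hy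
      rw [Matrix.mulVec_smul]
      apply Submodule.smul_mem
      rw [Matrix.sub_mulVec, Matrix.one_mulVec, hu _ (by omega), hF2 0 (by omega)]
      have := hgd (d - 1) (by omega)
      rwa [show d - (d - 1) - 1 = 0 by omega] at this
    | succ k ih =>
      intro hk y hy
      have h := hF2e (d - (k + 2)) (by omega)
      rw [show d - (d - (k + 2)) - 1 = k + 1 by omega,
        show d - (d - (k + 2)) = k + 1 + 1 by omega] at h
      rw [h] at hy
      obtain ⟨y, hy1, w, hw, rfl⟩ := Submodule.mem_sup.mp hy
      obtain ⟨t, rfl⟩ := Submodule.mem_span_singleton.mp hw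
      rw [Matrix.mulVec_add, Matrix.mulVec_smul]
      apply Submodule.add_mem
      · exact h2.1 (Nat.le_succ k) (ih (by omega) y hy1)
      · apply Submodule.smul_mem
        rw [Matrix.sub_mulVec, Matrix.one_mulVec, hu _ (by omega), hF2 (k + 1) (by omega)]
        have := hgd (d - (k + 2)) (by omega)
        rwa [show d - (d - (k + 2)) - 1 = k + 1 by omega] at this
  have hpow : ∀ k ≤ d, ∀ y ∈ F2 k, ((u - 1) ^ k).mulVec y = 0 := by
    intro k
    induction k with
    | zero =>
      intro _ y hy
      rw [hF2 0 (by omega), spn_zero] at hy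
      rw [(Submodule.mem_bot ℂ).mp hy, Matrix.mulVec_zero]
    | succ k ih =>
      intro hk y hy
      rw [pow_succ, ← Matrix.mulVec_mulVec]
      exact ih (by omega) _ (hdown k hk y hy)
  have hnil : IsNilpotent (u - 1) := by
    refine ⟨d, ?_⟩
    apply Matrix.mulVec_injective
    ext1 y
    rw [hpow d le_rfl y (by rw [hF2top]; trivial), Matrix.zero_mulVec]
  have hinj := unipotent_injective hnil
  have hGp : GenPos3 d F1 F2 (flagMap d u F3) := by
    rw [hGen]
    intro a b c habc
    rw [wedge_congr habc _ _ (w3 := g) (fun i hi => hu i (by omega))]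
    exact hgn a b c (by omega) habc
  refine ⟨u, ⟨hnil, ?_, ?_, hGp, ?_⟩, ?_⟩
  · funext k
    unfold flagMap
    apply Submodule.eq_of_le_of_finrank_le
    · rintro _ ⟨y, hy, rfl⟩
      by_cases hk : k < d
      · rw [Matrix.mulVecLin_apply, show u.mulVec y = (u - 1).mulVec y + y by
          rw [Matrix.sub_mulVec, Matrix.one_mulVec, sub_add_cancel]]
        exact Submodule.add_mem _ (hdown k hk y (h2.1 (Nat.le_succ k) hy)) hy
      · have : F2 k = ⊤ := by
          rw [eq_top_iff, ← hF2top]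
          exact h2.1 (by omega)
        rw [this]; trivial
    · exact (LinearEquiv.finrank_eq (Submodule.equivMapOfInjective u.mulVecLin hinj (F2 k))).le
  · rw [hF3 1 (by omega), spn_succ, spn_zero, bot_sup_eq, Submodule.map_span,
      Set.image_singleton, Matrix.mulVecLin_apply, hu 0 (by omega), hgz, hlspan]
  · intro j hj
    rw [hTr u hGp j hj, ← hgr j hj (by
      obtain ⟨q1, q2, q3, q4⟩ := hj
      omega)]
    obtain ⟨a, b, c, rfl, habc⟩ := memB_cases hj
    have hc : ∀ a b c, a + b + c = d → wedgeDet d a b (flagBasis d F1) (flagBasis d F2)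
        (fun c => u.mulVec (e c)) = wedgeDet d a b (flagBasis d F1) (flagBasis d F2) g :=
      fun a b c habc => wedge_congr habc _ _ (fun i hi => hu i (by omega))
    rw [rat_succ, rat_succ, hc (a + 1) b (c + 2) (by omega), hc a (b + 1) (c + 2) (by omega),
      hc (a + 2) (b + 1) c (by omega), hc a (b + 2) (c + 1) (by omega),
      hc (a + 1) (b + 2) c (by omega), hc (a + 2) b (c + 1) (by omega)]
  · rintro u' ⟨hnil', hfl', hul', hGp', hT'⟩
    obtain ⟨hz', hd'⟩ := hnec u' hnil' hfl' hul'
    have hcu := core_unique (flagBasis d F1) (flagBasis d F2) g (fun c => u'.mulVec (e c))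
      (by rw [hgz]; exact hz'.symm)
      (fun c hc => by
        have := Submodule.sub_mem _ (hd' c hc) (by
          rw [hF2 (d - c - 1) (by omega)]; exact hgd c (by omega))
        rw [sub_sub_sub_cancel_right, hF2 _ (by omega)] at this
        exact this)
      (fun a b c habc => hgn a b c (by omega) habc)
      (fun j hj => by
        rw [← hTr u' hGp' j hj, hT' j hj, hgr j hj (by
          obtain ⟨q1, q2, q3, q4⟩ := hj
          omega)])
    apply Matrix.mulVec_injective
    ext1 y
    have hy : y ∈ LinearMap.eqLocus u'.mulVecLin u.mulVecLin := by
      have : spn e d ≤ LinearMap.eqLocus u'.mulVecLin u.mulVecLin := by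
        apply spn_le
        intro i hi
        rw [LinearMap.mem_eqLocus, Matrix.mulVecLin_apply, Matrix.mulVecLin_apply, hu i hi]
        exact (hcu i hi).symm
      apply this
      rw [hF3top]; trivial
    exact hy
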